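/- Let P be a finite set of real numbers contained in [2,∞) and let E = ⊕_{p∈P} L_p be the product Banach space of the Lebesgue spaces L_p([0,1]). Let (ψ_n) be a semi-normalized, subsymmetric, unconditional basic sequence in E. Then there exist p ∈ P ∪ {2} and a constant D ≥ 1 such that D^{-1}(∑_n |a_n|^p)^{1/p} ≤ ‖∑_n a_n ψ_n‖ ≤ D(∑_n |a_n|^p)^{1/p} for every finitely supported scalar sequence (a_n); that is, (ψ_n) is equivalent to the unit vector system of ℓ_p for some p ∈ P ∪ {2}. -/

import Mathlib

open MeasureTheory Filter Topology

theorem Real.sq_rpow_half (p x : ℝ) : (x ^ 2) ^ (p / 2) = |x| ^ p := by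
  rw [← sq_abs x, ← Real.rpow_natCast, ← Real.rpow_mul (abs_nonneg _)]
  congr 1
  push_cast
  ring

theorem Real.abs_add_rpow_add_abs_sub_rpow_le {p : ℝ} (hp : 2 ≤ p) (a b : ℝ) :
    |a + b| ^ p + |a - b| ^ p ≤ 2 * (a ^ 2 + (Real.exp p + 4) * b ^ 2) ^ (p / 2) := by
  have hp0 : 0 < p := by linarith
  have habs := fun x : ℝ => (Real.sq_rpow_half p x).symm
  have he : 0 < Real.exp p := Real.exp_pos p
  rcases le_total |b| |a| with h | h
  · rcases eq_or_ne a 0 with rfl | ha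
    · have hb : b = 0 := by simpa using h
      subst hb
      simp [Real.zero_rpow hp0.ne', Real.zero_rpow (show p / 2 ≠ 0 by positivity)]
    obtain ⟨t, rfl⟩ : ∃ t, b = a * t := ⟨b / a, by field_simp⟩
    have ht : |t| ≤ 1 := by
      rw [abs_mul] at h
      exact le_of_mul_le_mul_left (by simpa using h) (abs_pos.2 ha)
    have key : ∀ s : ℝ, |s| ≤ 1 → |1 + s| ^ p ≤ Real.exp (p * s) := by
      intro s hs
      have h1 : 0 ≤ 1 + s := by linarith [(abs_le.1 hs).1]
      rw [abs_of_nonneg h1, mul_comm, Real.exp_mul]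
      exact Real.rpow_le_rpow h1 (by linarith [Real.add_one_le_exp s]) hp0.le
    have h1 := key t ht
    have h2 := key (-t) (by simpa using ht)
    have h3 : Real.exp (p * t) + Real.exp (p * -t) ≤ 2 * Real.exp (p * t ^ 2) ^ (p / 2) := by
      have := Real.cosh_le_exp_half_sq (p * t)
      rw [Real.cosh_eq] at this
      rw [← Real.exp_mul, show p * t ^ 2 * (p / 2) = (p * t) ^ 2 / 2 by ring, mul_neg]
      linarith
    have ht2 : t ^ 2 ≤ 1 := by rw [← sq_abs]; exact pow_le_one₀ (abs_nonneg _) ht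
    have h4 : Real.exp (p * t ^ 2) ≤ 1 + (Real.exp p + 4) * t ^ 2 := by
      have := convexOn_exp.2 (Set.mem_univ 0) (Set.mem_univ p)
        (show 0 ≤ 1 - t ^ 2 by linarith) (sq_nonneg t) (by ring)
      simp only [smul_eq_mul, mul_zero, zero_add, Real.exp_zero, mul_one] at this
      rw [mul_comm p]
      nlinarith [sq_nonneg t]
    have h5 : Real.exp (p * t ^ 2) ^ (p / 2) ≤ (1 + (Real.exp p + 4) * t ^ 2) ^ (p / 2) :=
      Real.rpow_le_rpow (Real.exp_pos _).le h4 (by positivity)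
    calc |a + a * t| ^ p + |a - a * t| ^ p
        = |a| ^ p * (|1 + t| ^ p + |1 + -t| ^ p) := by
          rw [show a + a * t = a * (1 + t) by ring, show a - a * t = a * (1 + -t) by ring,
            abs_mul, abs_mul, Real.mul_rpow (abs_nonneg _) (abs_nonneg _),
            Real.mul_rpow (abs_nonneg _) (abs_nonneg _)]
          ring
      _ ≤ |a| ^ p * (2 * (1 + (Real.exp p + 4) * t ^ 2) ^ (p / 2)) := by
          gcongr
          linarith
      _ = 2 * (a ^ 2 + (Real.exp p + 4) * (a * t) ^ 2) ^ (p / 2) := by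
          rw [habs, show a ^ 2 + (Real.exp p + 4) * (a * t) ^ 2
            = a ^ 2 * (1 + (Real.exp p + 4) * t ^ 2) by ring,
            Real.mul_rpow (by positivity) (by positivity)]
          ring
  · have hk : ∀ x : ℝ, |x| ≤ 2 * |b| →
        |x| ^ p ≤ (a ^ 2 + (Real.exp p + 4) * b ^ 2) ^ (p / 2) := by
      intro x hx
      rw [habs]
      refine Real.rpow_le_rpow (sq_nonneg _) ?_ (by positivity)
      have : x ^ 2 ≤ 4 * b ^ 2 := by
        rw [← sq_abs x, ← sq_abs b]
        nlinarith [abs_nonneg x, abs_nonneg b]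
      nlinarith [sq_nonneg a, sq_nonneg b]
    have h1 := hk (a + b) (by linarith [abs_add_le a b])
    have h2 := hk (a - b) (by linarith [abs_sub a b])
    linarith

theorem Real.add_rpow_two_mul_le {r X Y : ℝ} (hr : 1 ≤ r) (hX : 0 ≤ X) (hY : 0 ≤ Y) :
    2 * ((X + Y) / 2) ^ r ≤ X ^ r + Y ^ r := by
  have := (convexOn_rpow hr).2 (show X ∈ Set.Ici (0:ℝ) from hX) (show Y ∈ Set.Ici (0:ℝ) from hY)
    (show (0:ℝ) ≤ 1 / 2 by norm_num) (show (0:ℝ) ≤ 1 / 2 by norm_num) (by norm_num)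
  simp only [smul_eq_mul] at this
  rw [show (X + Y) / 2 = 1 / 2 * X + 1 / 2 * Y by ring]
  linarith

theorem Real.two_mul_abs_rpow_add_le {p : ℝ} (hp : 2 ≤ p) (a b : ℝ) :
    2 * (|a| ^ p + |b| ^ p) ≤ |a + b| ^ p + |a - b| ^ p := by
  have habs := fun x : ℝ => (Real.sq_rpow_half p x).symm
  have h1 := Real.add_rpow_two_mul_le (show 1 ≤ p / 2 by linarith) (sq_nonneg (a + b))
    (sq_nonneg (a - b))
  have h2 := Real.add_rpow_le_rpow_add (sq_nonneg a) (sq_nonneg b) (show 1 ≤ p / 2 by linarith)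
  rw [show ((a + b) ^ 2 + (a - b) ^ 2) / 2 = a ^ 2 + b ^ 2 by ring] at h1
  simp only [habs]
  linarith


theorem Finset.sum_ite_mem_eq_of_subset {ι R E : Type*} [Zero R] [AddCommMonoid E] [DecidableEq ι]
    {s t : Finset ι} (hst : s ⊆ t) (c : ι → R) (g : ι → R → E) (hg : ∀ i, g i 0 = 0) :
    ∑ i ∈ t, g i (if i ∈ s then c i else 0) = ∑ i ∈ s, g i (c i) := by
  rw [← Finset.sum_subset hst fun i _ hi => by simp [hi, hg]]
  exact Finset.sum_congr rfl fun i hi => by simp [hi]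

section LpInequalities

variable {Ω : Type*} [MeasurableSpace Ω] {μ : Measure Ω} {p : ℝ}

theorem MeasureTheory.Lp.integrable_abs_rpow (hp : 1 ≤ p) (f : Lp ℝ (ENNReal.ofReal p) μ) :
    Integrable (fun x => |f x| ^ p) μ := by
  have h := (Lp.memLp f).integrable_norm_rpow (by simp; linarith) ENNReal.ofReal_ne_top
  rwa [ENNReal.toReal_ofReal (by linarith)] at h

theorem MeasureTheory.Lp.integrable_sq [IsFiniteMeasure μ] (hp : 2 ≤ p)
    (f : Lp ℝ (ENNReal.ofReal p) μ) : Integrable (fun x => f x ^ 2) μ := by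
  refine MemLp.integrable_sq ((Lp.memLp f).mono_exponent ?_)
  rw [show (2 : ENNReal) = ENNReal.ofReal 2 by simp]
  exact ENNReal.ofReal_le_ofReal hp

theorem MeasureTheory.Lp.integral_sq_smul (c : ℝ) (f : Lp ℝ (ENNReal.ofReal p) μ) :
    ∫ x, (c • f) x ^ 2 ∂μ = c ^ 2 * ∫ x, f x ^ 2 ∂μ := by
  rw [← integral_const_mul]
  refine integral_congr_ae ?_
  filter_upwards [Lp.coeFn_smul c f] with x h1
  simp only [h1, Pi.smul_apply, smul_eq_mul]
  ring

theorem MeasureTheory.Lp.norm_rpow_eq_integral_abs (hp : 1 ≤ p)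
    (f : Lp ℝ (ENNReal.ofReal p) μ) : ‖f‖ ^ p = ∫ x, |f x| ^ p ∂μ := by
  have h0 : 0 ≤ ∫ x, |f x| ^ p ∂μ := integral_nonneg fun x => by positivity
  have hp0 : p ≠ 0 := by linarith
  rw [Lp.norm_def, (Lp.memLp f).eLpNorm_eq_integral_rpow_norm (by simp; linarith)
    ENNReal.ofReal_ne_top, ENNReal.toReal_ofReal (show 0 ≤ p by linarith)]
  simp only [Real.norm_eq_abs]
  rw [ENNReal.toReal_ofReal (by positivity), ← Real.rpow_mul h0, inv_mul_cancel₀ hp0,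
    Real.rpow_one]

theorem MeasureTheory.Lp.integral_sq_add_add_integral_sq_sub [IsFiniteMeasure μ] (hp : 2 ≤ p)
    (f g : Lp ℝ (ENNReal.ofReal p) μ) :
    ∫ x, (f + g) x ^ 2 ∂μ + ∫ x, (f - g) x ^ 2 ∂μ
      = 2 * (∫ x, f x ^ 2 ∂μ + ∫ x, g x ^ 2 ∂μ) := by
  rw [← integral_add (Lp.integrable_sq hp _) (Lp.integrable_sq hp _),
    ← integral_add (Lp.integrable_sq hp _) (Lp.integrable_sq hp _), ← integral_const_mul]
  refine integral_congr_ae ?_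
  filter_upwards [Lp.coeFn_add f g, Lp.coeFn_sub f g] with x h1 h2
  simp only [h1, h2, Pi.add_apply, Pi.sub_apply]
  ring

theorem MeasureTheory.Lp.two_mul_norm_rpow_add_le (hp : 2 ≤ p)
    (f g : Lp ℝ (ENNReal.ofReal p) μ) :
    2 * (‖f‖ ^ p + ‖g‖ ^ p) ≤ ‖f + g‖ ^ p + ‖f - g‖ ^ p := by
  have hp1 : 1 ≤ p := by linarith
  simp only [Lp.norm_rpow_eq_integral_abs hp1]
  rw [← integral_add (Lp.integrable_abs_rpow hp1 _) (Lp.integrable_abs_rpow hp1 _),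
    ← integral_add (Lp.integrable_abs_rpow hp1 _) (Lp.integrable_abs_rpow hp1 _),
    ← integral_const_mul]
  refine integral_mono_ae
    (((Lp.integrable_abs_rpow hp1 _).add (Lp.integrable_abs_rpow hp1 _)).const_mul 2)
    ((Lp.integrable_abs_rpow hp1 _).add (Lp.integrable_abs_rpow hp1 _)) ?_
  filter_upwards [Lp.coeFn_add f g, Lp.coeFn_sub f g] with x h1 h2
  simp only [h1, h2, Pi.add_apply, Pi.sub_apply]
  exact Real.two_mul_abs_rpow_add_le hp _ _

theorem MeasureTheory.Lp.norm_sup_rpow_le (hp : 1 ≤ p) (f g : Lp ℝ (ENNReal.ofReal p) μ) :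
    ‖f ⊔ g‖ ^ p ≤ ‖f‖ ^ p + ‖g‖ ^ p := by
  simp only [Lp.norm_rpow_eq_integral_abs hp]
  rw [← integral_add (Lp.integrable_abs_rpow hp _) (Lp.integrable_abs_rpow hp _)]
  refine integral_mono_ae (Lp.integrable_abs_rpow hp _)
    ((Lp.integrable_abs_rpow hp _).add (Lp.integrable_abs_rpow hp _)) ?_
  filter_upwards [Lp.coeFn_sup f g] with x h1
  simp only [h1, Pi.sup_apply]
  have h2 : 0 ≤ |f x| ^ p := by positivity
  have h3 : 0 ≤ |g x| ^ p := by positivity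
  rcases le_total (f x) (g x) with h | h
  · rw [sup_eq_right.2 h]; linarith
  · rw [sup_eq_left.2 h]; linarith

theorem MeasureTheory.Lp.smul_le_smul_of_nonneg {c d : ℝ} (hcd : c ≤ d)
    {x y : Lp ℝ (ENNReal.ofReal p) μ} (hd : 0 ≤ d) (hx : 0 ≤ x) (hxy : x ≤ y) : c • x ≤ d • y := by
  rw [← Lp.coeFn_nonneg] at hx
  rw [← Lp.coeFn_le] at hxy ⊢
  filter_upwards [hx, hxy, Lp.coeFn_smul c x, Lp.coeFn_smul d y] with t h1 h2 h3 h4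
  rw [h3, h4]
  simp only [Pi.zero_apply, Pi.smul_apply, smul_eq_mul] at *
  exact mul_le_mul hcd h2 h1 hd

theorem MeasureTheory.Lp.abs_sum_smul_le {ι : Type*} (A : Finset ι) (a : ι → ℝ)
    (f : ι → Lp ℝ (ENNReal.ofReal p) μ) : |∑ i ∈ A, a i • f i| ≤ ∑ i ∈ A, |a i| • |f i| := by
  classical
  induction A using Finset.induction_on with
  | empty => simp
  | insert i s hi ih =>
    rw [Finset.sum_insert hi, Finset.sum_insert hi]
    refine (abs_add_le _ _).trans (add_le_add (le_of_eq ?_) ih)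
    refine Lp.ext ?_
    filter_upwards [Lp.coeFn_abs (a i • f i), Lp.coeFn_abs (f i), Lp.coeFn_smul (a i) (f i),
      Lp.coeFn_smul |a i| |f i|] with x h1 h2 h3 h4
    rw [h1, h3, h4]
    simp only [Pi.smul_apply, smul_eq_mul, h2, abs_mul]

variable [Fact ((1 : ENNReal) ≤ ENNReal.ofReal p)]

theorem MeasureTheory.Lp.exists_sq (hp : 2 ≤ p) (f : Lp ℝ (ENNReal.ofReal p) μ) :
    ∃ F : Lp ℝ (ENNReal.ofReal (p / 2)) μ, (F =ᵐ[μ] fun x => f x ^ 2) ∧ ‖F‖ = ‖f‖ ^ 2 := by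
  have hp1 : 1 ≤ p := by linarith
  have hp2 : 1 ≤ p / 2 := by linarith
  have hp0 : p / 2 ≠ 0 := by linarith
  have : Fact ((1 : ENNReal) ≤ ENNReal.ofReal (p / 2)) := ⟨by simpa using hp2⟩
  have hm : MemLp (fun x => f x ^ 2) (ENNReal.ofReal (p / 2)) μ := by
    have hae : AEStronglyMeasurable (fun x => f x ^ 2) μ := (Lp.aestronglyMeasurable f).pow 2
    rw [← integrable_norm_rpow_iff hae (by simp; linarith)
      ENNReal.ofReal_ne_top, ENNReal.toReal_ofReal (by linarith)]
    simpa [Real.sq_rpow_half] using Lp.integrable_abs_rpow hp1 f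
  refine ⟨hm.toLp _, hm.coeFn_toLp, ?_⟩
  have h : ‖hm.toLp _‖ ^ (p / 2) = (‖f‖ ^ 2) ^ (p / 2) := by
    rw [Lp.norm_rpow_eq_integral_abs hp2, Real.sq_rpow_half, abs_norm,
      Lp.norm_rpow_eq_integral_abs hp1]
    refine integral_congr_ae ?_
    filter_upwards [hm.coeFn_toLp] with x hx
    rw [hx, abs_of_nonneg (sq_nonneg _), Real.sq_rpow_half]
  exact (Real.rpow_left_inj (norm_nonneg _) (by positivity) hp0).1 h

theorem MeasureTheory.Lp.norm_add_sq_add_norm_sub_sq_le (hp : 2 ≤ p)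
    (f g : Lp ℝ (ENNReal.ofReal p) μ) :
    ‖f + g‖ ^ 2 + ‖f - g‖ ^ 2 ≤ 2 * (‖f‖ ^ 2 + (Real.exp p + 4) * ‖g‖ ^ 2) := by
  have hp1 : 1 ≤ p := by linarith
  have hp2 : 1 ≤ p / 2 := by linarith
  have : Fact ((1 : ENNReal) ≤ ENNReal.ofReal (p / 2)) := ⟨by simpa using hp2⟩
  have hK : 0 < Real.exp p + 4 := by positivity
  obtain ⟨F, hF, hFn⟩ := Lp.exists_sq hp f
  obtain ⟨G, hG, hGn⟩ := Lp.exists_sq hp g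
  have h1 : ‖f + g‖ ^ p + ‖f - g‖ ^ p ≤ 2 * ‖F + (Real.exp p + 4) • G‖ ^ (p / 2) := by
    rw [Lp.norm_rpow_eq_integral_abs hp1, Lp.norm_rpow_eq_integral_abs hp1,
      Lp.norm_rpow_eq_integral_abs hp2, ← integral_const_mul,
      ← integral_add (Lp.integrable_abs_rpow hp1 _) (Lp.integrable_abs_rpow hp1 _)]
    refine integral_mono_ae
      ((Lp.integrable_abs_rpow hp1 _).add (Lp.integrable_abs_rpow hp1 _))
      ((Lp.integrable_abs_rpow hp2 _).const_mul 2) ?_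
    filter_upwards [Lp.coeFn_add f g, Lp.coeFn_sub f g, hF, hG,
      Lp.coeFn_add F ((Real.exp p + 4) • G), Lp.coeFn_smul (Real.exp p + 4) G]
      with x e1 e2 e3 e4 e5 e6
    simp only [e1, e2, e5, e6, Pi.add_apply, Pi.sub_apply, Pi.smul_apply, smul_eq_mul, e3, e4]
    rw [abs_of_nonneg (a := f x ^ 2 + _) (by positivity)]
    exact Real.abs_add_rpow_add_abs_sub_rpow_le hp _ _
  have h2 : ‖F + (Real.exp p + 4) • G‖ ≤ ‖f‖ ^ 2 + (Real.exp p + 4) * ‖g‖ ^ 2 := by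
    refine (norm_add_le _ _).trans ?_
    rw [norm_smul, hFn, hGn, Real.norm_of_nonneg hK.le]
  have h3 := Real.add_rpow_two_mul_le hp2 (sq_nonneg ‖f + g‖) (sq_nonneg ‖f - g‖)
  rw [Real.sq_rpow_half, Real.sq_rpow_half, abs_norm, abs_norm] at h3
  have h4 : ((‖f + g‖ ^ 2 + ‖f - g‖ ^ 2) / 2) ^ (p / 2)
      ≤ ‖F + (Real.exp p + 4) • G‖ ^ (p / 2) := by linarith
  have h5 := (Real.rpow_le_rpow_iff (by positivity) (norm_nonneg _) (by linarith)).1 h4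
  linarith

theorem MeasureTheory.Lp.integral_sq_le_norm_sq [IsProbabilityMeasure μ] (hp : 2 ≤ p)
    (f : Lp ℝ (ENNReal.ofReal p) μ) : ∫ x, f x ^ 2 ∂μ ≤ ‖f‖ ^ 2 := by
  have hp2 : 1 ≤ p / 2 := by linarith
  obtain ⟨F, hF, hFn⟩ := Lp.exists_sq hp f
  have h1 : (∫ x, f x ^ 2 ∂μ) = ∫ x, ‖F x‖ ∂μ := by
    refine integral_congr_ae ?_
    filter_upwards [hF] with x hx
    rw [hx, Real.norm_of_nonneg (sq_nonneg _)]
  rw [h1, ← hFn, Lp.norm_def, integral_norm_eq_lintegral_enorm (Lp.aestronglyMeasurable F),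
    ← eLpNorm_one_eq_lintegral_enorm]
  exact ENNReal.toReal_mono (Lp.eLpNorm_ne_top F)
    (eLpNorm_le_eLpNorm_of_exponent_le (by simpa using hp2) (Lp.aestronglyMeasurable F))

theorem MeasureTheory.Lp.tendsto_norm_abs_inf_abs_zero [IsFiniteMeasure μ] (hp : 2 ≤ p)
    (g : Lp ℝ (ENNReal.ofReal p) μ) {f : ℕ → Lp ℝ (ENNReal.ofReal p) μ}
    (hf : Tendsto (fun n => ∫ x, f n x ^ 2 ∂μ) atTop (𝓝 0)) :
    Tendsto (fun n => ‖|g| ⊓ |f n|‖) atTop (𝓝 0) := by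
  have hp1 : 1 ≤ p := by linarith
  have hp0 : 0 < p := by linarith
  refine tendsto_of_subseq_tendsto fun ns hns => ?_
  have hm : TendstoInMeasure μ (fun k x => f (ns k) x ^ 2) atTop (fun _ => 0) := by
    refine tendstoInMeasure_of_tendsto_eLpNorm (p := 1) one_ne_zero
      (fun k => (Lp.aestronglyMeasurable _).pow 2) aestronglyMeasurable_const ?_
    have h2 : ∀ k, eLpNorm ((fun x => f (ns k) x ^ 2) - fun _ => 0) 1 μ
        = ENNReal.ofReal (∫ x, f (ns k) x ^ 2 ∂μ) := by
      intro k
      rw [ofReal_integral_eq_lintegral_ofReal (Lp.integrable_sq hp _)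
        (ae_of_all _ fun x => sq_nonneg _), eLpNorm_one_eq_lintegral_enorm]
      refine lintegral_congr fun x => ?_
      simp [Real.enorm_eq_ofReal_abs, ← ENNReal.ofReal_pow]
    simp only [h2]
    simpa using ENNReal.tendsto_ofReal (hf.comp hns)
  obtain ⟨ms, -, hae⟩ := hm.exists_seq_tendsto_ae
  refine ⟨ms, ?_⟩
  have key : Tendsto (fun n => ∫ x, |(|g| ⊓ |f (ns (ms n))|) x| ^ p ∂μ) atTop
      (𝓝 (∫ _, (0 : ℝ) ∂μ)) := by
    refine tendsto_integral_of_dominated_convergence (fun x => |g x| ^ p)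
      (fun n => (Lp.integrable_abs_rpow hp1 _).aestronglyMeasurable)
      (Lp.integrable_abs_rpow hp1 g) (fun n => ?_) ?_
    · filter_upwards [Lp.coeFn_inf |g| |f (ns (ms n))|, Lp.coeFn_abs g,
        Lp.coeFn_abs (f (ns (ms n)))] with x h1 h2 h3
      rw [h1, Pi.inf_apply, h2, h3, Real.norm_of_nonneg (by positivity),
        abs_of_nonneg (le_inf (abs_nonneg _) (abs_nonneg _))]
      exact Real.rpow_le_rpow (le_inf (abs_nonneg _) (abs_nonneg _)) inf_le_left hp0.le
    · have hall : ∀ᵐ x ∂μ, ∀ n, (|g| ⊓ |f (ns (ms n))|) x = |g x| ⊓ |f (ns (ms n)) x| := by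
        rw [ae_all_iff]
        intro n
        filter_upwards [Lp.coeFn_inf |g| |f (ns (ms n))|, Lp.coeFn_abs g,
          Lp.coeFn_abs (f (ns (ms n)))] with x h1 h2 h3
        rw [h1, Pi.inf_apply, h2, h3]
      filter_upwards [hae, hall] with x hx1 hx2
      have hx3 : Tendsto (fun n => |f (ns (ms n)) x| ^ p) atTop (𝓝 0) := by
        have := hx1.rpow_const (p := p / 2) (Or.inr (by positivity))
        simpa [Real.sq_rpow_half, Real.zero_rpow (show p / 2 ≠ 0 by positivity)] using this
      refine squeeze_zero (fun n => by positivity) (fun n => ?_) hx3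
      rw [hx2, abs_of_nonneg (le_inf (abs_nonneg _) (abs_nonneg _))]
      exact Real.rpow_le_rpow (le_inf (abs_nonneg _) (abs_nonneg _)) inf_le_right hp0.le
  simp only [← Lp.norm_rpow_eq_integral_abs hp1, integral_zero] at key
  have := key.rpow_const (p := p⁻¹) (Or.inr (by positivity))
  rw [Real.zero_rpow (by positivity)] at this
  refine this.congr fun n => ?_
  rw [Real.rpow_rpow_inv (norm_nonneg _) hp0.ne']

theorem MeasureTheory.Lp.norm_inf_le_mul_norm_inf {c : ℝ} (hc : 0 ≤ c)
    {u v x y : Lp ℝ (ENNReal.ofReal p) μ} (hu : 0 ≤ u) (hux : u ≤ c • x) (hv : 0 ≤ v)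
    (hvy : v ≤ c • y) : ‖u ⊓ v‖ ≤ c * ‖x ⊓ y‖ := by
  rw [← Real.norm_of_nonneg hc, ← norm_smul]
  refine norm_le_norm_of_abs_le_abs ?_
  rw [abs_of_nonneg (le_inf hu hv)]
  refine le_trans ?_ (le_abs_self _)
  rw [← Lp.coeFn_le] at hux hvy ⊢
  filter_upwards [hux, hvy, Lp.coeFn_inf u v, Lp.coeFn_inf x y, Lp.coeFn_smul c (x ⊓ y),
    Lp.coeFn_smul c x, Lp.coeFn_smul c y] with t h1 h2 h3 h4 h5 h6 h7
  simp only [h3, h4, h5, h6, h7, Pi.inf_apply, Pi.smul_apply, smul_eq_mul] at *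
  rw [mul_min_of_nonneg _ _ hc]
  exact min_le_min h1 h2

/-- A nonnegative combination of almost disjoint positive elements is their supremum plus a
small remainder. -/
theorem MeasureTheory.Lp.exists_sum_smul_eq_add (hp : 1 ≤ p)
    {x : ℕ → Lp ℝ (ENNReal.ofReal p) μ} (hx : ∀ n, 0 ≤ x n) {b : ℕ → ℝ}
    (hb : ∀ n, ‖(∑ k ∈ Finset.range n, x k) ⊓ x n‖ ≤ b n) {c : ℕ → ℝ} {R : ℝ}
    (hc : ∀ n, 0 ≤ c n) (hcR : ∀ n, c n ≤ R) (N : ℕ) :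
    ∃ M H : Lp ℝ (ENNReal.ofReal p) μ, ∑ k ∈ Finset.range N, c k • x k = M + H ∧ 0 ≤ M ∧
      M ≤ R • ∑ k ∈ Finset.range N, x k ∧
      ‖M‖ ^ p ≤ ∑ k ∈ Finset.range N, c k ^ p * ‖x k‖ ^ p ∧
      ‖H‖ ≤ R * ∑ k ∈ Finset.range N, b k := by
  have hR : 0 ≤ R := (hc 0).trans (hcR 0)
  induction N with
  | zero => exact ⟨0, 0, by simp [Real.zero_rpow (show p ≠ 0 by linarith)]⟩
  | succ N ih =>
    obtain ⟨M, H, hsum, hM, hMR, hMn, hHn⟩ := ih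
    have hcx : 0 ≤ c N • x N := by
      simpa using Lp.smul_le_smul_of_nonneg (hc N) (hc N) le_rfl (hx N)
    have hcxR : c N • x N ≤ R • x N := Lp.smul_le_smul_of_nonneg (hcR N) hR (hx N) le_rfl
    have hS : 0 ≤ R • ∑ k ∈ Finset.range N, x k := hM.trans hMR
    have hRx : 0 ≤ R • x N := hcx.trans hcxR
    refine ⟨M ⊔ c N • x N, H + M ⊓ c N • x N, ?_, le_sup_of_le_left hM, ?_, ?_, ?_⟩
    · rw [Finset.sum_range_succ, hsum, add_left_comm, add_comm (M ⊔ _), inf_add_sup]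
      abel
    · rw [Finset.sum_range_succ, smul_add]
      exact sup_le (hMR.trans (le_add_of_nonneg_right hRx))
        (hcxR.trans (le_add_of_nonneg_left hS))
    · rw [Finset.sum_range_succ]
      refine (Lp.norm_sup_rpow_le hp _ _).trans (add_le_add hMn ?_)
      rw [norm_smul, Real.norm_of_nonneg (hc N), Real.mul_rpow (hc N) (norm_nonneg _)]
    · rw [Finset.sum_range_succ, mul_add]
      refine (norm_add_le _ _).trans (add_le_add hHn ?_)
      exact (Lp.norm_inf_le_mul_norm_inf hR hM hMR hcx hcxR).trans
        (mul_le_mul_of_nonneg_left (hb N) hR)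

theorem MeasureTheory.Lp.norm_sum_smul_le_of_almost_disjoint (hp : 1 ≤ p)
    {f : ℕ → Lp ℝ (ENNReal.ofReal p) μ} {C : ℝ} (hC : ∀ n, ‖f n‖ ≤ C)
    (hf : ∀ n, ‖(∑ k ∈ Finset.range n, |f k|) ⊓ |f n|‖ ≤ (1 / 2 : ℝ) ^ n)
    (A : Finset ℕ) (a : ℕ → ℝ) :
    ‖∑ n ∈ A, a n • f n‖ ≤ (C + 2) * (∑ n ∈ A, |a n| ^ p) ^ (1 / p) := by
  classical
  have hp0 : 0 < p := by linarith
  have hC0 : 0 ≤ C := (norm_nonneg _).trans (hC 0)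
  obtain ⟨N, hN⟩ : ∃ N, A ⊆ Finset.range N := A.exists_nat_subset_range
  set c : ℕ → ℝ := fun n => if n ∈ A then |a n| else 0 with hcdef
  set T : ℝ := ∑ n ∈ A, |a n| ^ p with hT
  have hT0 : 0 ≤ T := Finset.sum_nonneg fun n _ => by positivity
  have hc : ∀ n, 0 ≤ c n := fun n => by simp only [hcdef]; split_ifs <;> positivity
  have hcT : ∀ n, c n ≤ T ^ (1 / p) := by
    intro n
    by_cases hn : n ∈ A
    · have h1 : |a n| ^ p ≤ T :=
        Finset.single_le_sum (f := fun n => |a n| ^ p) (fun n _ => by positivity) hn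
      have h2 := Real.rpow_le_rpow (by positivity) h1 (show 0 ≤ 1 / p by positivity)
      rw [one_div, Real.rpow_rpow_inv (abs_nonneg _) hp0.ne'] at h2
      simpa [hcdef, hn] using h2
    · simp only [hcdef, hn, if_false]
      positivity
  obtain ⟨M, H, hsum, -, -, hM, hH⟩ :=
    Lp.exists_sum_smul_eq_add hp (fun n => abs_nonneg (f n)) hf hc hcT N
  have hM' : ‖M‖ ≤ C * T ^ (1 / p) := by
    have h1 : ‖M‖ ^ p ≤ C ^ p * T := by
      refine hM.trans ?_
      calc ∑ k ∈ Finset.range N, c k ^ p * ‖|f k|‖ ^ p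
          ≤ ∑ k ∈ Finset.range N, C ^ p * c k ^ p := by
            refine Finset.sum_le_sum fun k _ => ?_
            rw [norm_abs_eq_norm, mul_comm]
            have := hc k
            gcongr
            exact hC k
        _ = C ^ p * T := by
            rw [← Finset.mul_sum, Finset.sum_ite_mem_eq_of_subset hN (fun n => |a n|) (fun _ t => t ^ p)
              fun _ => Real.zero_rpow hp0.ne']
    have h2 := Real.rpow_le_rpow (by positivity) h1 (show 0 ≤ 1 / p by positivity)
    rw [Real.mul_rpow (by positivity) hT0] at h2
    rwa [one_div, Real.rpow_rpow_inv (norm_nonneg _) hp0.ne',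
      Real.rpow_rpow_inv hC0 hp0.ne', ← one_div] at h2
  have hH' : ‖H‖ ≤ T ^ (1 / p) * 2 := by
    refine hH.trans (mul_le_mul_of_nonneg_left ?_ (by positivity))
    exact sum_geometric_two_le N
  calc ‖∑ n ∈ A, a n • f n‖ ≤ ‖∑ n ∈ A, |a n| • |f n|‖ :=
        norm_le_norm_of_abs_le_abs ((Lp.abs_sum_smul_le A a f).trans (le_abs_self _))
    _ = ‖M + H‖ := by
        rw [← hsum, Finset.sum_ite_mem_eq_of_subset hN (fun n => |a n|) (fun k t => t • |f k|)
          fun _ => zero_smul _ _]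
    _ ≤ ‖M‖ + ‖H‖ := norm_add_le _ _
    _ ≤ (C + 2) * T ^ (1 / p) := by linarith

end LpInequalities

theorem exists_signs_le_sum {ι E : Type*} [AddCommGroup E] [Module ℝ E] {Φ Ψ : E → ℝ}
    (h0 : Φ 0 ≤ 0) (h : ∀ x y, Φ (x + y) + Φ (x - y) ≤ 2 * (Φ x + Ψ y)) (x : ι → E)
    (A : Finset ι) :
    ∃ ε : ι → ℝ, (∀ i, |ε i| = 1) ∧ Φ (∑ i ∈ A, ε i • x i) ≤ ∑ i ∈ A, Ψ (x i) := by
  classical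
  induction A using Finset.induction_on with
  | empty => exact ⟨fun _ => 1, by simp, by simpa using h0⟩
  | insert i s hi ih =>
    obtain ⟨ε, hε, hs⟩ := ih
    have hupd : ∀ t : ℝ, ∑ j ∈ insert i s, Function.update ε i t j • x j
        = ∑ j ∈ s, ε j • x j + t • x i := by
      intro t
      rw [Finset.sum_insert hi, Function.update_self, add_comm]
      congr 1
      exact Finset.sum_congr rfl fun j hj => by
        rw [Function.update_of_ne (ne_of_mem_of_not_mem hj hi)]
    have habs : ∀ t : ℝ, |t| = 1 → ∀ j, |Function.update ε i t j| = 1 := by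
      intro t ht j
      rcases eq_or_ne j i with rfl | hj
      · simpa using ht
      · rw [Function.update_of_ne hj, hε]
    have := h (∑ j ∈ s, ε j • x j) (x i)
    rcases le_total (Φ (∑ j ∈ s, ε j • x j + x i)) (Φ (∑ j ∈ s, ε j • x j - x i)) with hle | hle
    · refine ⟨Function.update ε i 1, habs 1 (by simp), ?_⟩
      rw [hupd, one_smul, Finset.sum_insert hi]
      linarith
    · refine ⟨Function.update ε i (-1), habs (-1) (by simp), ?_⟩
      rw [hupd, neg_one_smul, ← sub_eq_add_neg, Finset.sum_insert hi]
      linarith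

theorem exists_signs_sum_le {ι E : Type*} [AddCommGroup E] [Module ℝ E] {Φ : E → ℝ}
    (h0 : 0 ≤ Φ 0) (h : ∀ x y, 2 * (Φ x + Φ y) ≤ Φ (x + y) + Φ (x - y)) (x : ι → E)
    (A : Finset ι) :
    ∃ ε : ι → ℝ, (∀ i, |ε i| = 1) ∧ ∑ i ∈ A, Φ (x i) ≤ Φ (∑ i ∈ A, ε i • x i) := by
  obtain ⟨ε, hε, hs⟩ := exists_signs_le_sum (Φ := fun x => -Φ x) (Ψ := fun x => -Φ x)
    (by simpa using h0) (fun x y => by linarith [h x y]) x A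
  refine ⟨ε, hε, ?_⟩
  rw [Finset.sum_neg_distrib] at hs
  linarith

theorem exists_strictMono_forall_image_range {R : ℕ → Finset ℕ → ℕ → Prop}
    (h : ∀ k s, ∃ n, (∀ m ∈ s, m < n) ∧ R k s n) :
    ∃ f : ℕ → ℕ, StrictMono f ∧ ∀ k, R k ((Finset.range k).image f) (f k) := by
  choose g hg hR using h
  let S : ℕ → Finset ℕ := fun k => Nat.rec ∅ (fun k s => insert (g k s) s) k
  have hS : ∀ k, S (k + 1) = insert (g k (S k)) (S k) := fun _ => rfl
  have himage : ∀ k, S k = (Finset.range k).image fun j => g j (S j) := by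
    intro k
    induction k with
    | zero => rfl
    | succ k ih => rw [hS, Finset.range_add_one, Finset.image_insert, ← ih]
  refine ⟨fun k => g k (S k), strictMono_nat_of_lt_succ fun k => ?_, fun k => ?_⟩
  · exact hg (k + 1) (S (k + 1)) _ (by rw [hS]; exact Finset.mem_insert_self _ _)
  · rw [← himage]
    exact hR k (S k)

section DirectSum

variable {Ω : Type*} [MeasurableSpace Ω] {μ : Measure Ω} {P : Finset ℝ}
  [∀ p : P, Fact ((1 : ENNReal) ≤ ENNReal.ofReal (p : ℝ))]

theorem exists_signs_norm_sq_le (hP : ∀ p ∈ P, (2 : ℝ) ≤ p) :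
    ∃ K : ℝ, 0 ≤ K ∧ ∀ (x : ℕ → ((p : P) → Lp ℝ (ENNReal.ofReal (p : ℝ)) μ)) (A : Finset ℕ),
      ∃ ε : ℕ → ℝ, (∀ i, |ε i| = 1) ∧ ‖∑ i ∈ A, ε i • x i‖ ^ 2 ≤ K * ∑ i ∈ A, ‖x i‖ ^ 2 := by
  refine ⟨∑ p : P, (Real.exp (p : ℝ) + 4), Finset.sum_nonneg fun p _ => by positivity,
    fun x A => ?_⟩
  obtain ⟨ε, hε, h⟩ := exists_signs_le_sum
    (E := (p : P) → Lp ℝ (ENNReal.ofReal (p : ℝ)) μ)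
    (Φ := fun y => ∑ p : P, ‖y p‖ ^ 2)
    (Ψ := fun y => ∑ p : P, (Real.exp (p : ℝ) + 4) * ‖y p‖ ^ 2) (by simp) (fun y z => by
      rw [← Finset.sum_add_distrib, ← Finset.sum_add_distrib, Finset.mul_sum]
      exact Finset.sum_le_sum fun p _ => Lp.norm_add_sq_add_norm_sub_sq_le (hP p p.2) _ _) x A
  refine ⟨ε, hε, le_trans ?_ (h.trans ?_)⟩
  · rw [← Real.le_sqrt (norm_nonneg _) (Finset.sum_nonneg fun p _ => sq_nonneg _)]
    refine (pi_norm_le_iff_of_nonneg (Real.sqrt_nonneg _)).2 fun p => ?_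
    rw [Real.le_sqrt (norm_nonneg _) (Finset.sum_nonneg fun p _ => sq_nonneg _)]
    exact Finset.single_le_sum (f := fun p : P => ‖(∑ i ∈ A, ε i • x i) p‖ ^ 2)
      (fun p _ => sq_nonneg _) (Finset.mem_univ p)
  · rw [Finset.mul_sum]
    refine Finset.sum_le_sum fun i _ => ?_
    rw [Finset.sum_mul]
    refine Finset.sum_le_sum fun p _ => ?_
    have := norm_le_pi_norm (x i) p
    gcongr

theorem exists_signs_mul_sum_sq_le [IsProbabilityMeasure μ] (hP : ∀ p ∈ P, (2 : ℝ) ≤ p)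
    {x : ℕ → ((p : P) → Lp ℝ (ENNReal.ofReal (p : ℝ)) μ)} (p : P) {δ : ℝ}
    (hδ : ∀ n, δ ≤ ∫ t, x n p t ^ 2 ∂μ) (A : Finset ℕ) (a : ℕ → ℝ) :
    ∃ ε : ℕ → ℝ, (∀ i, |ε i| = 1) ∧
      δ * ∑ i ∈ A, a i ^ 2 ≤ ‖∑ i ∈ A, ε i • a i • x i‖ ^ 2 := by
  have hp := hP p p.2
  obtain ⟨ε, hε, h⟩ := exists_signs_sum_le
    (E := (p : P) → Lp ℝ (ENNReal.ofReal (p : ℝ)) μ)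
    (Φ := fun y => ∫ t, y p t ^ 2 ∂μ) (integral_nonneg fun t => sq_nonneg _)
    (fun y z => (Lp.integral_sq_add_add_integral_sq_sub hp (y p) (z p)).ge)
    (fun i => a i • x i) A
  refine ⟨ε, hε, le_trans ?_ (h.trans ((Lp.integral_sq_le_norm_sq hp _).trans ?_))⟩
  · rw [Finset.mul_sum]
    refine Finset.sum_le_sum fun i _ => ?_
    rw [Pi.smul_apply, Lp.integral_sq_smul, mul_comm]
    exact mul_le_mul_of_nonneg_left (hδ i) (sq_nonneg _)
  · exact pow_le_pow_left₀ (norm_nonneg _) (norm_le_pi_norm _ p) 2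

theorem exists_signs_mul_sum_rpow_le (hP : ∀ p ∈ P, (2 : ℝ) ≤ p)
    {x : ℕ → ((p : P) → Lp ℝ (ENNReal.ofReal (p : ℝ)) μ)} (p : P) {δ : ℝ} (hδ0 : 0 ≤ δ)
    (hδ : ∀ n, δ ≤ ‖x n p‖) (A : Finset ℕ) (a : ℕ → ℝ) :
    ∃ ε : ℕ → ℝ, (∀ i, |ε i| = 1) ∧
      δ * (∑ i ∈ A, |a i| ^ (p : ℝ)) ^ (1 / (p : ℝ)) ≤ ‖∑ i ∈ A, ε i • a i • x i‖ := by
  have hp := hP p p.2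
  have hp0 : (0 : ℝ) < p := by linarith
  obtain ⟨ε, hε, h⟩ := exists_signs_sum_le
    (E := (p : P) → Lp ℝ (ENNReal.ofReal (p : ℝ)) μ)
    (Φ := fun y => ‖y p‖ ^ (p : ℝ)) (by positivity)
    (fun y z => Lp.two_mul_norm_rpow_add_le hp (y p) (z p))
    (fun i => a i • x i) A
  refine ⟨ε, hε, le_trans ?_ (norm_le_pi_norm _ p)⟩
  have h1 : δ ^ (p : ℝ) * ∑ i ∈ A, |a i| ^ (p : ℝ)
      ≤ ‖(∑ i ∈ A, ε i • a i • x i) p‖ ^ (p : ℝ) := by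
    refine le_trans ?_ h
    rw [Finset.mul_sum]
    refine Finset.sum_le_sum fun i _ => ?_
    rw [Pi.smul_apply, norm_smul, Real.norm_eq_abs,
      Real.mul_rpow (abs_nonneg _) (norm_nonneg _), mul_comm]
    gcongr
    exact hδ i
  have hT : 0 ≤ ∑ i ∈ A, |a i| ^ (p : ℝ) := Finset.sum_nonneg fun i _ => by positivity
  have h2 := Real.rpow_le_rpow (by positivity) h1 (show 0 ≤ 1 / (p : ℝ) by positivity)
  rw [Real.mul_rpow (by positivity) hT] at h2
  rwa [one_div, Real.rpow_rpow_inv (norm_nonneg _) hp0.ne',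
    Real.rpow_rpow_inv hδ0 hp0.ne', ← one_div] at h2

theorem sum_rpow_rpow_one_div_antitone {r s : ℝ} (hr : 0 < r) (hrs : r ≤ s) (A : Finset ℕ)
    (a : ℕ → ℝ) :
    (∑ n ∈ A, |a n| ^ s) ^ (1 / s) ≤ (∑ n ∈ A, |a n| ^ r) ^ (1 / r) := by
  have hs : 0 < s := hr.trans_le hrs
  set T := ∑ n ∈ A, |a n| ^ r with hT
  have hT0 : 0 ≤ T := Finset.sum_nonneg fun n _ => by positivity
  have h : ∑ n ∈ A, |a n| ^ s ≤ T ^ (s / r) := by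
    rcases hrs.eq_or_lt with rfl | hlt
    · simp [div_self hr.ne', hT]
    calc ∑ n ∈ A, |a n| ^ s ≤ ∑ n ∈ A, |a n| ^ r * T ^ ((s - r) / r) := by
          refine Finset.sum_le_sum fun n hn => ?_
          have h1 : |a n| ^ r ≤ T :=
            Finset.single_le_sum (f := fun n => |a n| ^ r) (fun n _ => by positivity) hn
          have h2 := Real.rpow_le_rpow (by positivity) h1
            (show 0 ≤ (s - r) / r from div_nonneg (by linarith) hr.le)
          rw [← Real.rpow_mul (abs_nonneg _), mul_div_cancel₀ _ hr.ne'] at h2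
          calc |a n| ^ s = |a n| ^ r * |a n| ^ (s - r) := by
                rw [← Real.rpow_add_of_nonneg (abs_nonneg _) hr.le (by linarith)]
                congr 1
                ring
            _ ≤ _ := by gcongr
      _ = T ^ (s / r) := by
          rw [← Finset.sum_mul, ← hT]
          nth_rewrite 1 [← Real.rpow_one T]
          rw [← Real.rpow_add_of_nonneg hT0 zero_le_one (div_nonneg (by linarith) hr.le)]
          congr 1
          field_simp
          ring
  have h2 := Real.rpow_le_rpow (Finset.sum_nonneg fun n _ => by positivity) h
    (show 0 ≤ 1 / s by positivity)
  rwa [← Real.rpow_mul hT0, show s / r * (1 / s) = 1 / r by field_simp] at h2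

/-- If the coordinates of `x` tend to zero in `L₂` and `p` is minimal such that the `p`-th
coordinate does not tend to zero in norm, then some subsequence of `x` is dominated by `ℓ_p`,
and its `p`-th coordinate is bounded below. -/
theorem exists_subseq_norm_sum_le [IsFiniteMeasure μ] (hP : ∀ p ∈ P, (2 : ℝ) ≤ p)
    {x : ℕ → ((p : P) → Lp ℝ (ENNReal.ofReal (p : ℝ)) μ)} {C : ℝ} (hC : ∀ n, ‖x n‖ ≤ C)
    (hx : ∀ p : P, Tendsto (fun n => ∫ t, x n p t ^ 2 ∂μ) atTop (𝓝 0)) (p : P) {δ : ℝ}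
    (hδ : ∃ᶠ n in atTop, δ ≤ ‖x n p‖)
    (hlt : ∀ r : P, (r : ℝ) < p → Tendsto (fun n => ‖x n r‖) atTop (𝓝 0)) :
    ∃ π : ℕ → ℕ, StrictMono π ∧ (∀ n, δ ≤ ‖x (π n) p‖) ∧
      ∀ (A : Finset ℕ) (a : ℕ → ℝ),
        ‖∑ n ∈ A, a n • x (π n)‖
          ≤ (C + 2) * (∑ n ∈ A, |a n| ^ (p : ℝ)) ^ (1 / (p : ℝ)) := by
  classical
  have hp := hP p p.2
  have hp0 : (0 : ℝ) < p := by linarith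
  have hC0 : 0 ≤ C := (norm_nonneg _).trans (hC 0)
  obtain ⟨π, hπ, hR⟩ := exists_strictMono_forall_image_range
    (R := fun k s n => δ ≤ ‖x n p‖ ∧
      (∀ r : P, ‖(∑ m ∈ s, |x m r|) ⊓ |x n r|‖ ≤ (1 / 2 : ℝ) ^ k) ∧
      ∀ r : P, (r : ℝ) < p → ‖x n r‖ ≤ (1 / 2 : ℝ) ^ k) (by
    intro k s
    have hk : (0 : ℝ) < (1 / 2) ^ k := by positivity
    have h1 : ∀ᶠ n in atTop, ∀ m ∈ s, m < n := by
      rw [Filter.eventually_all_finset]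
      exact fun m _ => eventually_gt_atTop m
    have h2 : ∀ᶠ n in atTop, ∀ r : P,
        ‖(∑ m ∈ s, |x m r|) ⊓ |x n r|‖ ≤ (1 / 2 : ℝ) ^ k := by
      rw [Filter.eventually_all]
      intro r
      have := Lp.tendsto_norm_abs_inf_abs_zero (hP r r.2) (∑ m ∈ s, |x m r|) (hx r)
      rw [abs_of_nonneg (Finset.sum_nonneg fun m _ => abs_nonneg (x m r))] at this
      exact this.eventually_le_const hk
    have h3 : ∀ᶠ n in atTop, ∀ r : P, (r : ℝ) < p → ‖x n r‖ ≤ (1 / 2 : ℝ) ^ k := by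
      rw [Filter.eventually_all]
      intro r
      by_cases hr : (r : ℝ) < p
      · filter_upwards [(hlt r hr).eventually_le_const hk] with n hn _ using hn
      · exact Eventually.of_forall fun n h => absurd h hr
    obtain ⟨n, hn, hn1, hn2, hn3⟩ := (hδ.and_eventually (h1.and (h2.and h3))).exists
    exact ⟨n, hn1, hn, hn2, hn3⟩)
  have hdis : ∀ (r : P) n,
      ‖(∑ k ∈ Finset.range n, |x (π k) r|) ⊓ |x (π n) r|‖ ≤ (1 / 2 : ℝ) ^ n := by
    intro r n
    have := (hR n).2.1 r
    rwa [Finset.sum_image hπ.injective.injOn] at this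
  refine ⟨π, hπ, fun n => (hR n).1, fun A a => ?_⟩
  set T := (∑ n ∈ A, |a n| ^ (p : ℝ)) ^ (1 / (p : ℝ)) with hT
  have hT0 : 0 ≤ T := Real.rpow_nonneg (Finset.sum_nonneg fun n _ => by positivity) _
  refine (pi_norm_le_iff_of_nonneg (by positivity)).2 fun r => ?_
  have hsum : (∑ n ∈ A, a n • x (π n)) r = ∑ n ∈ A, a n • x (π n) r := by
    simp [Finset.sum_apply]
  rw [hsum]
  rcases lt_or_ge (r : ℝ) p with hr | hr
  · have haT : ∀ n ∈ A, |a n| ≤ T := by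
      intro n hn
      have h1 : |a n| ^ (p : ℝ) ≤ ∑ n ∈ A, |a n| ^ (p : ℝ) :=
        Finset.single_le_sum (f := fun n => |a n| ^ (p : ℝ)) (fun n _ => by positivity) hn
      have h2 := Real.rpow_le_rpow (by positivity) h1 (show 0 ≤ 1 / (p : ℝ) by positivity)
      nth_rewrite 1 [one_div] at h2
      rwa [Real.rpow_rpow_inv (abs_nonneg _) hp0.ne'] at h2
    obtain ⟨N, hN⟩ : ∃ N, A ⊆ Finset.range N := A.exists_nat_subset_range
    calc ‖∑ n ∈ A, a n • x (π n) r‖ ≤ ∑ n ∈ A, T * (1 / 2 : ℝ) ^ n := by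
          refine norm_sum_le_of_le _ fun n hn => ?_
          rw [norm_smul, Real.norm_eq_abs]
          exact mul_le_mul (haT n hn) ((hR n).2.2 r hr) (norm_nonneg _) hT0
      _ ≤ ∑ n ∈ Finset.range N, T * (1 / 2 : ℝ) ^ n :=
          Finset.sum_le_sum_of_subset_of_nonneg hN fun n _ _ => by positivity
      _ ≤ T * 2 := by
          rw [← Finset.mul_sum]
          exact mul_le_mul_of_nonneg_left (sum_geometric_two_le N) hT0
      _ ≤ (C + 2) * T := by nlinarith
  · refine (Lp.norm_sum_smul_le_of_almost_disjoint (by linarith)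
      (fun n => (norm_le_pi_norm _ r).trans (hC (π n))) (hdis r) A a).trans ?_
    exact mul_le_mul_of_nonneg_left (sum_rpow_rpow_one_div_antitone hp0 hr A a) (by positivity)


/-- The classification over an arbitrary probability measure. -/
theorem exists_equivalent_unit_vectors_of_subsymmetric [IsProbabilityMeasure μ]
    (hP : ∀ p ∈ P, (2 : ℝ) ≤ p)
    (ψ : ℕ → ((p : P) → Lp ℝ (ENNReal.ofReal (p : ℝ)) μ))
    (hsn : ∃ c C : ℝ, 0 < c ∧ ∀ n, c ≤ ‖ψ n‖ ∧ ‖ψ n‖ ≤ C)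
    (hunc : ∃ C : ℝ, ∀ (A : Finset ℕ) (a b : ℕ → ℝ), (∀ n, |a n| ≤ |b n|) →
      ‖∑ n ∈ A, a n • ψ n‖ ≤ C * ‖∑ n ∈ A, b n • ψ n‖)
    (hss : ∀ π : ℕ → ℕ, StrictMono π → ∃ Cπ : ℝ, 1 ≤ Cπ ∧
      ∀ (A : Finset ℕ) (a : ℕ → ℝ),
        Cπ⁻¹ * ‖∑ n ∈ A, a n • ψ n‖ ≤ ‖∑ n ∈ A, a n • ψ (π n)‖ ∧
        ‖∑ n ∈ A, a n • ψ (π n)‖ ≤ Cπ * ‖∑ n ∈ A, a n • ψ n‖) :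
    ∃ p : ℝ, (p ∈ P ∨ p = 2) ∧ ∃ D : ℝ, 1 ≤ D ∧
      ∀ (A : Finset ℕ) (a : ℕ → ℝ),
        D⁻¹ * (∑ n ∈ A, |a n| ^ p) ^ (1 / p) ≤ ‖∑ n ∈ A, a n • ψ n‖ ∧
        ‖∑ n ∈ A, a n • ψ n‖ ≤ D * (∑ n ∈ A, |a n| ^ p) ^ (1 / p) := by
  suffices h : ∃ p : ℝ, (p ∈ P ∨ p = 2) ∧ ∃ L U : ℝ, 0 < L ∧ ∀ (A : Finset ℕ) (a : ℕ → ℝ),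
      L * (∑ n ∈ A, |a n| ^ p) ^ (1 / p) ≤ ‖∑ n ∈ A, a n • ψ n‖ ∧
      ‖∑ n ∈ A, a n • ψ n‖ ≤ U * (∑ n ∈ A, |a n| ^ p) ^ (1 / p) by
    obtain ⟨p, hp, L, U, hL, h⟩ := h
    refine ⟨p, hp, max 1 (max L⁻¹ U), le_max_left _ _, fun A a => ?_⟩
    have hT : 0 ≤ (∑ n ∈ A, |a n| ^ p) ^ (1 / p) :=
      Real.rpow_nonneg (Finset.sum_nonneg fun n _ => by positivity) _
    refine ⟨le_trans (mul_le_mul_of_nonneg_right ?_ hT) (h A a).1,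
      (h A a).2.trans (mul_le_mul_of_nonneg_right ?_ hT)⟩
    · exact inv_le_of_inv_le₀ hL ((le_max_left _ _).trans (le_max_right _ _))
    · exact (le_max_right _ _).trans (le_max_right _ _)
  obtain ⟨c, C, hc, hcC⟩ := hsn
  have hC0 : 0 ≤ C := (norm_nonneg _).trans (hcC 0).2
  obtain ⟨B, hB1, hB⟩ : ∃ B : ℝ, 1 ≤ B ∧ ∀ (A : Finset ℕ) (a b : ℕ → ℝ),
      (∀ n, |a n| = |b n|) → ‖∑ n ∈ A, a n • ψ n‖ ≤ B * ‖∑ n ∈ A, b n • ψ n‖ := by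
    obtain ⟨B, hB⟩ := hunc
    refine ⟨max 1 B, le_max_left _ _, fun A a b hab => (hB A a b fun n => (hab n).le).trans ?_⟩
    exact mul_le_mul_of_nonneg_right (le_max_right _ _) (norm_nonneg _)
  have hB0 : 0 < B := by linarith
  -- A lower estimate for a subsequence up to signs is a lower estimate for the sequence.
  have hlower : ∀ (π : ℕ → ℕ), StrictMono π → ∃ M : ℝ, 0 < M ∧
      ∀ (A : Finset ℕ) (a ε : ℕ → ℝ), (∀ i, |ε i| = 1) →
        ‖∑ n ∈ A, ε n • a n • ψ (π n)‖ ≤ M * ‖∑ n ∈ A, a n • ψ n‖ := by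
    intro π hπ
    obtain ⟨Cπ, hCπ, h⟩ := hss π hπ
    refine ⟨Cπ * B, by positivity, fun A a ε hε => ?_⟩
    simp only [smul_smul]
    refine (h A fun n => ε n * a n).2.trans ?_
    rw [mul_assoc]
    exact mul_le_mul_of_nonneg_left
      (hB A _ _ fun n => by rw [abs_mul, hε, one_mul]) (by linarith)
  by_cases hcase : ∀ p : P, Tendsto (fun n => ∫ t, ψ n p t ^ 2 ∂μ) atTop (𝓝 0)
  · have hne : ({p : P | ¬ Tendsto (fun n => ‖ψ n p‖) atTop (𝓝 0)} : Set P).Nonempty := by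
      by_contra hempty
      rw [Set.not_nonempty_iff_eq_empty, Set.eq_empty_iff_forall_notMem] at hempty
      have h0 : Tendsto ψ atTop (𝓝 0) := by
        rw [tendsto_pi_nhds]
        intro p
        exact tendsto_zero_iff_norm_tendsto_zero.2 (not_not.1 (hempty p))
      obtain ⟨n, hn⟩ := (h0.norm.eventually_lt_const (by simpa using hc)).exists
      exact (hcC n).1.not_gt hn
    obtain ⟨p, hp, hmin⟩ := (Set.toFinite _).exists_minimal hne
    have hlt : ∀ r : P, (r : ℝ) < p → Tendsto (fun n => ‖ψ n r‖) atTop (𝓝 0) := by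
      intro r hr
      by_contra hcon
      exact hr.not_ge (hmin hcon hr.le)
    obtain ⟨δ, hδ, hfreq⟩ : ∃ δ > 0, ∃ᶠ n in atTop, δ ≤ ‖ψ n p‖ := by
      by_contra! hcon
      refine hp (Metric.tendsto_nhds.2 fun δ hδ => ?_)
      filter_upwards [hcon δ hδ] with n hn
      simpa using hn
    obtain ⟨π, hπ, hπδ, hupper⟩ :=
      exists_subseq_norm_sum_le hP (fun n => (hcC n).2) hcase p hfreq hlt
    obtain ⟨M, hM, hlow⟩ := hlower π hπ
    obtain ⟨Cπ, hCπ, h⟩ := hss π hπ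
    refine ⟨p, Or.inl p.2, M⁻¹ * δ, Cπ * (C + 2), by positivity, fun A a => ⟨?_, ?_⟩⟩
    · obtain ⟨ε, hε, hle⟩ :=
        exists_signs_mul_sum_rpow_le hP (x := fun n => ψ (π n)) p hδ.le hπδ A a
      rw [mul_assoc, inv_mul_le_iff₀ hM]
      exact hle.trans (hlow A a ε hε)
    · have h1 := (h A a).1
      rw [inv_mul_le_iff₀ (by linarith)] at h1
      rw [mul_assoc]
      exact h1.trans (mul_le_mul_of_nonneg_left (hupper A a) (by linarith))
  · push Not at hcase
    obtain ⟨p, hp⟩ := hcase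
    obtain ⟨δ, hδ, hfreq⟩ : ∃ δ > 0, ∃ᶠ n in atTop, δ ≤ ∫ t, ψ n p t ^ 2 ∂μ := by
      by_contra! hcon
      refine hp (Metric.tendsto_nhds.2 fun δ hδ => ?_)
      filter_upwards [hcon δ hδ] with n hn
      have h0 : 0 ≤ ∫ t, ψ n p t ^ 2 ∂μ := integral_nonneg fun t => sq_nonneg _
      simpa [abs_of_nonneg h0] using hn
    obtain ⟨π, hπ, hπδ⟩ := extraction_of_frequently_atTop hfreq
    obtain ⟨M, hM, hlow⟩ := hlower π hπ
    obtain ⟨K, hK, hupper⟩ := exists_signs_norm_sq_le (μ := μ) hP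
    have hsqrt : ∀ (A : Finset ℕ) (a : ℕ → ℝ),
        (∑ n ∈ A, |a n| ^ (2 : ℝ)) ^ (1 / (2 : ℝ)) = √(∑ n ∈ A, a n ^ 2) := by
      intro A a
      simp [Real.sqrt_eq_rpow]
    refine ⟨2, Or.inr rfl, M⁻¹ * √δ, B * √(K * C ^ 2), by positivity, fun A a => ⟨?_, ?_⟩⟩
    · obtain ⟨ε, hε, hle⟩ := exists_signs_mul_sum_sq_le hP (x := fun n => ψ (π n)) p hπδ A a
      rw [hsqrt, mul_assoc, ← Real.sqrt_mul hδ.le, inv_mul_le_iff₀ hM]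
      exact (Real.sqrt_le_left (norm_nonneg _)).2 hle |>.trans (hlow A a ε hε)
    · obtain ⟨ε, hε, hle⟩ := hupper (fun n => a n • ψ n) A
      rw [hsqrt, mul_assoc, ← Real.sqrt_mul (by positivity)]
      have h1 : ‖∑ n ∈ A, ε n • a n • ψ n‖ ≤ √(K * C ^ 2 * ∑ n ∈ A, a n ^ 2) := by
        refine Real.le_sqrt_of_sq_le (hle.trans ?_)
        rw [mul_assoc]
        refine mul_le_mul_of_nonneg_left ?_ hK
        rw [Finset.mul_sum]
        refine Finset.sum_le_sum fun n _ => ?_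
        rw [norm_smul, mul_pow, Real.norm_eq_abs, sq_abs, mul_comm]
        have := (hcC n).2
        gcongr
      refine (hB A a (fun n => ε n * a n) fun n => by rw [abs_mul, hε, one_mul]).trans ?_
      simp only [smul_smul] at h1
      exact mul_le_mul_of_nonneg_left h1 hB0.le

end DirectSum

/-- Let `P ⊂ [2,∞)` be finite and `E = ⊕_{p ∈ P} L_p([0,1])` (product with the
maximum norm). Any semi-normalized, subsymmetric, unconditional basic sequence in `E` is
equivalent to the unit vector system of `ℓ_p` for some `p ∈ P ∪ {2}`. -/
theorem statement7 (P : Finset ℝ) (hP : ∀ p ∈ P, (2 : ℝ) ≤ p)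
    [∀ p : P, Fact ((1 : ENNReal) ≤ ENNReal.ofReal (p : ℝ))]
    (ψ : ℕ → ((p : P) → Lp ℝ (ENNReal.ofReal (p : ℝ)) (volume.restrict (Set.Icc (0:ℝ) 1))))
    -- semi-normalized
    (hsn : ∃ c C : ℝ, 0 < c ∧ ∀ n, c ≤ ‖ψ n‖ ∧ ‖ψ n‖ ≤ C)
    -- unconditional basic sequence
    (hunc : ∃ C : ℝ, ∀ (A : Finset ℕ) (a b : ℕ → ℝ), (∀ n, |a n| ≤ |b n|) →
      ‖∑ n ∈ A, a n • ψ n‖ ≤ C * ‖∑ n ∈ A, b n • ψ n‖)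
    -- subsymmetric
    (hss : ∀ π : ℕ → ℕ, StrictMono π → ∃ Cπ : ℝ, 1 ≤ Cπ ∧
      ∀ (A : Finset ℕ) (a : ℕ → ℝ),
        Cπ⁻¹ * ‖∑ n ∈ A, a n • ψ n‖ ≤ ‖∑ n ∈ A, a n • ψ (π n)‖ ∧
        ‖∑ n ∈ A, a n • ψ (π n)‖ ≤ Cπ * ‖∑ n ∈ A, a n • ψ n‖) :
    ∃ p : ℝ, (p ∈ P ∨ p = 2) ∧ ∃ D : ℝ, 1 ≤ D ∧
      ∀ (A : Finset ℕ) (a : ℕ → ℝ),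
        D⁻¹ * (∑ n ∈ A, |a n| ^ p) ^ (1 / p) ≤ ‖∑ n ∈ A, a n • ψ n‖ ∧
        ‖∑ n ∈ A, a n • ψ n‖ ≤ D * (∑ n ∈ A, |a n| ^ p) ^ (1 / p) := by
  have : IsProbabilityMeasure (volume.restrict (Set.Icc (0:ℝ) 1)) := ⟨by simp⟩
  exact exists_equivalent_unit_vectors_of_subsymmetric hP ψ hsn hunc hss
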